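/- Convergence of synchronous cross-entropy temporal-difference (CETD) learning. Let a finite MDP with discount factor γ ∈ [0,1) be given and let π be a Markov policy, with distributional Bellman operator (T^π_γ μ)(x'|x,a) = (1-γ) P(x'|x,a) + γ ∑_{x''} ∑_{a''} P(x''|x,a) π(a''|x'') μ(x'|x'',a''), whose unique fixed point among families of probability distributions is the discounted future state-visitation distribution μ^π_γ. Let (Ω, F, Pr) be a probability space with a filtration (F_k)_{k≥0}, let φ₀ ∈ ℝ^{X×A×X} be deterministic, and let (φ_k)_{k≥0} be a sequence of F_k-measurable random elements of ℝ^{X×A×X} with μ_k(·|x,a) = softmax(φ_k(x,a,·)). Suppose the updates have the form φ_{k+1}(x,a,·) = φ_k(x,a,·) + ε_k (Δ_k(x,a) - μ_k(·|x,a)) for every (x,a), where each Δ_k(x,a) is an F_{k+1}-measurable random vector in ℝ^X satisfying: (i) ‖Δ_k(x,a)‖ ≤ C almost surely for a uniform constant C; (ii) E[Δ_k(x,a) | F_k] = (T^π_γ μ_k)(·|x,a) almost surely. If the deterministic step sizes satisfy ∑_{k≥0} ε_k = ∞ and ∑_{k≥0} ε_k² < ∞, then almost surely μ_k(·|x,a)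 → μ^π_γ(·|x,a) for every (x,a). -/

import Mathlib

open scoped BigOperators
open MeasureTheory Filter

/-- The state-action transition matrix `S^π((x,a),(x',a')) = P(x'|x,a) π(a'|x')`. -/
def stateActionMatrix {X A : Type} [Fintype X] [Fintype A]
    (P : X → A → X → ℝ) (π : X → A → ℝ) : Matrix (X × A) (X × A) ℝ :=
  Matrix.of fun p q => P p.1 p.2 q.1 * π q.1 q.2

/-- The discounted future state-visitation distribution
`μ^π_γ(x'|x,a) = (1-γ) ∑_{k≥0} γ^k ∑_{a'} (S^π)^{k+1}((x,a),(x',a'))`, the unique fixed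
point of the distributional Bellman operator `T^π_γ` among families of probability
distributions. -/
noncomputable def visit {X A : Type} [Fintype X] [Fintype A] [DecidableEq X] [DecidableEq A]
    (P : X → A → X → ℝ) (π : X → A → ℝ) (γ : ℝ) (x : X) (a : A) (x' : X) : ℝ :=
  (1 - γ) * ∑' k : ℕ, γ ^ k * ∑ a' : A, (stateActionMatrix P π ^ (k + 1)) (x, a) (x', a')

/-- `softmax(φ)_i = exp(φ_i) / ∑_j exp(φ_j)`. -/
noncomputable def softmax {ι : Type} [Fintype ι] (φ : ι → ℝ) (i : ι) : ℝ :=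
  Real.exp (φ i) / ∑ j, Real.exp (φ j)


lemma aux_exp_quad (v M : ℝ) (h : |v| ≤ M) : Real.exp v ≤ 1 + v + M ^ 2 * Real.exp M := by
  have hM : 0 ≤ M := (abs_nonneg v).trans h
  have h1 := Real.add_one_le_exp v
  have h2 := Real.add_one_le_exp (-v)
  have h3 : Real.exp v * Real.exp (-v) = 1 := by rw [← Real.exp_add]; simp
  have h4 := Real.exp_pos v
  have h5 : Real.exp v * (1 - v) ≤ 1 := by nlinarith
  have h6 : v ^ 2 ≤ M ^ 2 := sq_le_sq' (by linarith [abs_le.1 h]) (abs_le.1 h).2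
  rcases le_total 0 v with hv | hv
  · have h7 : Real.exp v ≤ Real.exp M := Real.exp_le_exp.2 (abs_le.1 h).2
    have h8 : v ^ 2 * Real.exp v ≤ M ^ 2 * Real.exp M := by gcongr
    nlinarith
  · have h7 : 1 ≤ Real.exp M := Real.one_le_exp hM
    nlinarith [mul_le_mul_of_nonneg_left h7 (sq_nonneg M)]

lemma aux_sum_pos {ι : Type} [Fintype ι] [Nonempty ι] (φ : ι → ℝ) : 0 < ∑ j, Real.exp (φ j) :=
  Finset.sum_pos (fun _ _ => Real.exp_pos _) Finset.univ_nonempty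

lemma aux_softmax_nonneg {ι : Type} [Fintype ι] (φ : ι → ℝ) (i : ι) : 0 ≤ softmax φ i := by
  unfold softmax; positivity

lemma aux_softmax_sum {ι : Type} [Fintype ι] [Nonempty ι] (φ : ι → ℝ) : ∑ i, softmax φ i = 1 := by
  unfold softmax
  rw [← Finset.sum_div]
  exact div_self (aux_sum_pos φ).ne'

lemma aux_softmax_le {ι : Type} [Fintype ι] [Nonempty ι] (φ : ι → ℝ) (i : ι) :
    softmax φ i ≤ 1 := by
  rw [← aux_softmax_sum φ]
  exact Finset.single_le_sum (fun j _ => aux_softmax_nonneg φ j) (Finset.mem_univ i)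

lemma aux_sum_shift {ι : Type} [Fintype ι] [Nonempty ι] (φ v : ι → ℝ) :
    ∑ j, Real.exp (φ j + v j) = (∑ j, Real.exp (φ j)) * ∑ j, softmax φ j * Real.exp (v j) := by
  rw [Finset.mul_sum]
  refine Finset.sum_congr rfl fun j _ => ?_
  have := (aux_sum_pos φ).ne'
  unfold softmax
  rw [Real.exp_add]
  field_simp

lemma aux_lse_step {ι : Type} [Fintype ι] [Nonempty ι] (φ v : ι → ℝ) (M : ℝ)
    (h : ∀ i, |v i| ≤ M) :
    Real.log (∑ j, Real.exp (φ j + v j)) ≤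
      Real.log (∑ j, Real.exp (φ j)) + ∑ i, softmax φ i * v i + M ^ 2 * Real.exp M := by
  have hZ : 0 < ∑ j, softmax φ j * Real.exp (v j) := by
    have h1 := aux_sum_shift φ v
    have h2 := aux_sum_pos φ
    have h3 := aux_sum_pos (fun j => φ j + v j)
    rw [h1] at h3
    exact pos_of_mul_pos_right h3 h2.le
  rw [aux_sum_shift, Real.log_mul (aux_sum_pos φ).ne' hZ.ne']
  have h1 := Real.log_le_sub_one_of_pos hZ
  have h2 : ∑ j, softmax φ j * Real.exp (v j) ≤
      ∑ j, softmax φ j * (1 + v j + M ^ 2 * Real.exp M) :=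
    Finset.sum_le_sum fun j _ =>
      mul_le_mul_of_nonneg_left (aux_exp_quad _ _ (h j)) (aux_softmax_nonneg φ j)
  have h3 : ∑ j, softmax φ j * (1 + v j + M ^ 2 * Real.exp M)
      = 1 + ∑ i, softmax φ i * v i + M ^ 2 * Real.exp M := by
    simp only [mul_add, Finset.sum_add_distrib, ← Finset.sum_mul, aux_softmax_sum]
    ring
  linarith

lemma aux_lse_lower {ι : Type} [Fintype ι] [Nonempty ι] (φ m : ι → ℝ) (h0 : ∀ i, 0 ≤ m i)
    (h1 : ∑ i, m i = 1) : 0 ≤ Real.log (∑ j, Real.exp (φ j)) - ∑ i, m i * φ i := by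
  have h2 : ∀ i, φ i ≤ Real.log (∑ j, Real.exp (φ j)) := fun i => by
    rw [Real.le_log_iff_exp_le (aux_sum_pos φ)]
    exact Finset.single_le_sum (f := fun j => Real.exp (φ j))
      (fun j _ => (Real.exp_pos _).le) (Finset.mem_univ i)
  have h3 : ∑ i, m i * φ i ≤ ∑ i, m i * Real.log (∑ j, Real.exp (φ j)) :=
    Finset.sum_le_sum fun i _ => mul_le_mul_of_nonneg_left (h2 i) (h0 i)
  rw [← Finset.sum_mul, h1] at h3
  linarith

lemma aux_softmax_lip {ι : Type} [Fintype ι] [Nonempty ι] (φ v : ι → ℝ) (M : ℝ)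
    (h : ∀ i, |v i| ≤ M) (i : ι) :
    |softmax (fun j => φ j + v j) i - softmax φ i| ≤ 2 * M * Real.exp (2 * M) := by
  have hM : 0 ≤ M := (abs_nonneg _).trans (h i)
  have hd : ∀ j, |Real.exp (v i) - Real.exp (v j)| ≤ 2 * M * Real.exp M := by
    intro j
    have key : ∀ a b : ℝ, |a| ≤ M → |b| ≤ M → Real.exp a - Real.exp b ≤ 2 * M * Real.exp M := by
      intro a b ha hb
      have h1 := Real.add_one_le_exp (b - a)
      have h2 : Real.exp b = Real.exp a * Real.exp (b - a) := by rw [← Real.exp_add]; ring_nf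
      have h3 := Real.exp_pos a
      have h4 : Real.exp a ≤ Real.exp M := Real.exp_le_exp.2 (abs_le.1 ha).2
      have h5 : a - b ≤ 2 * M := by linarith [abs_le.1 ha, abs_le.1 hb]
      have h6 : Real.exp a * (a - b) ≤ Real.exp a * (2 * M) := by gcongr
      have h7 : Real.exp a * (2 * M) ≤ Real.exp M * (2 * M) := by gcongr
      nlinarith
    rw [abs_le]
    constructor
    · linarith [key (v j) (v i) (h j) (h i)]
    · exact key _ _ (h i) (h j)
  set Z := ∑ j, softmax φ j * Real.exp (v j) with hZ
  have hZl : Real.exp (-M) ≤ Z := by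
    have : ∑ j, softmax φ j * Real.exp (-M) ≤ Z := Finset.sum_le_sum fun j _ =>
      mul_le_mul_of_nonneg_left (Real.exp_le_exp.2 (abs_le.1 (h j)).1) (aux_softmax_nonneg φ j)
    rwa [← Finset.sum_mul, aux_softmax_sum, one_mul] at this
  have hZ0 : 0 < Z := (Real.exp_pos _).trans_le hZl
  have e1 : softmax (fun j => φ j + v j) i = softmax φ i * Real.exp (v i) / Z := by
    have := (aux_sum_pos φ).ne'
    unfold softmax at hZ ⊢
    rw [aux_sum_shift, Real.exp_add]
    unfold softmax
    rw [← hZ]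
    field_simp
  have e2 : |Real.exp (v i) - Z| ≤ 2 * M * Real.exp M := by
    have : Real.exp (v i) - Z = ∑ j, softmax φ j * (Real.exp (v i) - Real.exp (v j)) := by
      simp only [mul_sub, Finset.sum_sub_distrib, ← Finset.sum_mul, aux_softmax_sum, hZ, one_mul]
    rw [this]
    calc _ ≤ ∑ j, |softmax φ j * (Real.exp (v i) - Real.exp (v j))| := Finset.abs_sum_le_sum_abs _ _
      _ ≤ ∑ j, softmax φ j * (2 * M * Real.exp M) := by
        refine Finset.sum_le_sum fun j _ => ?_
        rw [abs_mul, abs_of_nonneg (aux_softmax_nonneg φ j)]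
        exact mul_le_mul_of_nonneg_left (hd j) (aux_softmax_nonneg φ j)
      _ = _ := by rw [← Finset.sum_mul, aux_softmax_sum, one_mul]
  have e3 : softmax (fun j => φ j + v j) i - softmax φ i
      = softmax φ i * (Real.exp (v i) - Z) / Z := by
    rw [e1]; field_simp
  rw [e3, abs_div, abs_mul, abs_of_nonneg (aux_softmax_nonneg φ i), abs_of_pos hZ0,
    div_le_iff₀ hZ0]
  have e4 : Real.exp (2 * M) * Real.exp (-M) = Real.exp M := by rw [← Real.exp_add]; ring_nf
  calc softmax φ i * |Real.exp (v i) - Z| ≤ 1 * (2 * M * Real.exp M) :=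
        mul_le_mul (aux_softmax_le φ i) e2 (abs_nonneg _) zero_le_one
    _ = 2 * M * Real.exp (2 * M) * Real.exp (-M) := by rw [← e4]; ring
    _ ≤ _ := by gcongr

lemma aux_cube (ε a : ℕ → ℝ) (hε0 : ∀ k, 0 ≤ ε k) (hεdiv : ¬ Summable ε)
    (hεsq : Summable fun k => ε k ^ 2) (K : ℝ)
    (ha : ∀ k, |a (k + 1) - a k| ≤ K * ε k) (hs : Summable fun k => ε k * a k ^ 2) :
    Tendsto a atTop (nhds 0) := by
  obtain ⟨E, hE⟩ : ∃ E, ∀ k, ε k ≤ E := by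
    have h1 : Tendsto (fun k => ε k ^ 2) atTop (nhds 0) := hεsq.tendsto_atTop_zero
    obtain ⟨E, hE⟩ := h1.bddAbove_range
    refine ⟨E + 1, fun k => ?_⟩
    have := hE ⟨k, rfl⟩
    simp only at this
    nlinarith [sq_nonneg (ε k - 1), sq_nonneg (ε k), hε0 k]
  have hcau : Summable fun k => a (k + 1) ^ 3 - a k ^ 3 := by
    have hb : Summable fun k => (9/2 * |K|) * (ε k * a k ^ 2) + (3 * |K| ^ 3 * E) * ε k ^ 2 :=
      (hs.mul_left _).add (hεsq.mul_left _)
    refine Summable.of_norm_bounded hb fun k => ?_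
    have h0 := hε0 k
    have h1 : |a (k+1) - a k| ≤ |K| * ε k :=
      (ha k).trans (mul_le_mul_of_nonneg_right (le_abs_self K) h0)
    set d := a (k+1) - a k with hd
    have h2 : a (k + 1) = a k + d := by rw [hd]; ring
    have h3 : a (k+1) ^ 3 - a k ^ 3 = d * (3 * a k ^ 2 + 3 * a k * d + d ^ 2) := by rw [h2]; ring
    have h4 : |3 * a k ^ 2 + 3 * a k * d + d ^ 2| ≤ 9/2 * a k ^ 2 + 3 * d ^ 2 := by
      rw [abs_le]; constructor <;> nlinarith [sq_nonneg (a k + d), sq_nonneg (a k - d), sq_nonneg (a k), sq_nonneg d]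
    have h5 : d ^ 2 ≤ (|K| * ε k) ^ 2 := by
      rw [← sq_abs d]; gcongr
    rw [Real.norm_eq_abs, h3, abs_mul]
    calc |d| * |3 * a k ^ 2 + 3 * a k * d + d ^ 2|
        ≤ (|K| * ε k) * (9/2 * a k ^ 2 + 3 * (|K| * ε k) ^ 2) := by
          refine mul_le_mul h1 (h4.trans (by linarith)) (abs_nonneg _) (by positivity)
      _ = (9/2 * |K|) * (ε k * a k ^ 2) + (3 * |K| ^ 3 * ε k) * ε k ^ 2 := by ring
      _ ≤ _ := by gcongr; exact hE k
  have hlim := hcau.hasSum.tendsto_sum_nat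
  simp only [Finset.sum_range_sub (fun k => a k ^ 3)] at hlim
  have hlim2 := hlim.add_const (a 0 ^ 3)
  simp only [sub_add_cancel] at hlim2
  set ℓ := (∑' k, (a (k + 1) ^ 3 - a k ^ 3)) + a 0 ^ 3
  have habs : Tendsto (fun k => |a k| ^ 3) atTop (nhds |ℓ|) := by
    simpa [abs_pow] using hlim2.abs
  have hℓ : ℓ = 0 := by
    by_contra hne
    have hpos : 0 < |ℓ| := abs_pos.2 hne
    apply hεdiv
    set δ := min 1 (|ℓ| / 2) with hδ
    have hδ0 : 0 < δ := lt_min one_pos (by linarith)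
    have hev : ∀ᶠ k in atTop, |ℓ| / 2 < |a k| ^ 3 := habs.eventually (lt_mem_nhds (by linarith))
    have hev2 : ∀ᶠ k in atTop, ‖ε k‖ ≤ (1 / δ ^ 2) * (ε k * a k ^ 2) := by
      filter_upwards [hev] with k hk
      have h1 : δ ≤ |a k| := by
        by_contra hlt
        push Not at hlt
        have h2 : |a k| ≤ 1 := hlt.le.trans (min_le_left _ _)
        have h3 : |a k| ^ 3 ≤ |a k| := by
          have := abs_nonneg (a k)
          nlinarith [mul_nonneg this this, mul_nonneg this (sub_nonneg.2 h2), mul_nonneg (mul_nonneg this this) (sub_nonneg.2 h2)]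
        have h4 : δ ≤ |ℓ| / 2 := min_le_right _ _
        linarith
      have h2 : δ ^ 2 ≤ a k ^ 2 := by rw [← sq_abs (a k)]; gcongr
      rw [Real.norm_of_nonneg (hε0 k), one_div, inv_mul_eq_div, le_div_iff₀ (by positivity)]
      exact mul_le_mul_of_nonneg_left h2 (hε0 k)
    exact Summable.of_norm_bounded_eventually_nat (hs.mul_left _) hev2
  rw [hℓ, abs_zero] at habs
  rw [tendsto_zero_iff_abs_tendsto_zero]
  have h := habs.rpow_const (p := (1/3 : ℝ)) (Or.inr (by norm_num))
  rw [Real.zero_rpow (by norm_num)] at h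
  refine h.congr fun k => ?_
  rw [← Real.rpow_natCast, ← Real.rpow_mul (abs_nonneg _)]
  norm_num

lemma aux_drift {I X : Type} [Fintype I] [Fintype X] (S : I → I → ℝ) (hS0 : ∀ p q, 0 ≤ S p q)
    (hS1 : ∀ p, ∑ q, S p q = 1) (γ : ℝ) (hγ0 : 0 ≤ γ) (w : I → ℝ) (hw : ∀ p, 0 ≤ w p)
    (hwS : ∀ q, γ * ∑ p, w p * S p q ≤ w q) (d : I → X → ℝ) :
    ∑ p, w p * ∑ x, d p x * (γ * ∑ q, S p q * d q x - d p x) ≤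
      -((1 - γ) / 2) * ∑ p, w p * ∑ x, d p x ^ 2 := by
  set D := fun p => ∑ x, d p x ^ 2 with hD
  have hD0 : ∀ p, 0 ≤ D p := fun p => Finset.sum_nonneg fun x _ => sq_nonneg _
  have h1 : ∀ p, ∑ x, d p x * (γ * ∑ q, S p q * d q x - d p x) ≤
      γ / 2 * D p + γ / 2 * (∑ q, S p q * D q) - D p := by
    intro p
    have h2 : ∀ x, d p x * (γ * ∑ q, S p q * d q x - d p x) ≤
        γ / 2 * d p x ^ 2 + γ / 2 * (∑ q, S p q * d q x ^ 2) - d p x ^ 2 := by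
      intro x
      have h3 : d p x * ∑ q, S p q * d q x ≤ 1/2 * d p x ^ 2 + 1/2 * ∑ q, S p q * d q x ^ 2 := by
        have : 1/2 * d p x ^ 2 = ∑ q, S p q * (1/2 * d p x ^ 2) := by
          rw [← Finset.sum_mul, hS1, one_mul]
        rw [this, Finset.mul_sum, Finset.mul_sum, ← Finset.sum_add_distrib]
        refine Finset.sum_le_sum fun q _ => ?_
        nlinarith [mul_nonneg (hS0 p q) (sq_nonneg (d p x - d q x))]
      nlinarith [mul_le_mul_of_nonneg_left h3 hγ0]
    refine (Finset.sum_le_sum fun x _ => h2 x).trans (le_of_eq ?_)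
    simp only [Finset.sum_sub_distrib, Finset.sum_add_distrib, ← Finset.mul_sum, hD]
    rw [Finset.sum_comm]
    simp only [← Finset.mul_sum]
  have h4 : ∑ p, w p * (γ / 2 * (∑ q, S p q * D q)) ≤ 1 / 2 * ∑ q, w q * D q := by
    have : ∑ p, w p * (γ / 2 * (∑ q, S p q * D q)) = 1/2 * ∑ q, (γ * ∑ p, w p * S p q) * D q := by
      simp only [Finset.mul_sum, Finset.sum_mul]
      rw [Finset.sum_comm]
      refine Finset.sum_congr rfl fun q _ => Finset.sum_congr rfl fun p _ => ?_
      ring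
    rw [this]
    gcongr with q _
    exact hwS q
  calc _ ≤ ∑ p, w p * (γ / 2 * D p + γ / 2 * (∑ q, S p q * D q) - D p) :=
        Finset.sum_le_sum fun p _ => mul_le_mul_of_nonneg_left (h1 p) (hw p)
    _ = γ / 2 * ∑ p, w p * D p + ∑ p, w p * (γ / 2 * (∑ q, S p q * D q)) - ∑ p, w p * D p := by
        rw [Finset.mul_sum, ← Finset.sum_add_distrib, ← Finset.sum_sub_distrib]
        exact Finset.sum_congr rfl fun p _ => by ring
    _ ≤ _ := by linarith

lemma aux_weight {I : Type} [Fintype I] [DecidableEq I] (S : Matrix I I ℝ)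
    (hS0 : ∀ p q, 0 ≤ S p q)
    (hS1 : ∀ p, ∑ q, S p q = 1) (γ : ℝ) (hγ0 : 0 ≤ γ) (hγ1 : γ < 1) :
    (∀ k p q, 0 ≤ (S ^ k) p q) ∧ (∀ k p, ∑ q, (S ^ k) p q = 1) ∧
    ∃ w : I → ℝ, (∀ q, 1 ≤ w q) ∧ ∀ q, γ * ∑ p, w p * S p q ≤ w q := by
  have h0 : ∀ k p q, 0 ≤ (S ^ k) p q := by
    intro k
    induction k with
    | zero => intro p q; rw [pow_zero, Matrix.one_apply]; split_ifs <;> norm_num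
    | succ k ih =>
      intro p q
      rw [pow_succ, Matrix.mul_apply]
      exact Finset.sum_nonneg fun r _ => mul_nonneg (ih _ _) (hS0 _ _)
  have h1 : ∀ k p, ∑ q, (S ^ k) p q = 1 := by
    intro k
    induction k with
    | zero => intro p; simp [Matrix.one_apply]
    | succ k ih =>
      intro p
      simp only [pow_succ, Matrix.mul_apply]
      rw [Finset.sum_comm]
      simp only [← Finset.mul_sum, hS1, mul_one, ih]
  refine ⟨h0, h1, ?_⟩
  have hle : ∀ k p q, (S ^ k) p q ≤ 1 := fun k p q => by
    rw [← h1 k p]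
    exact Finset.single_le_sum (f := fun q => (S ^ k) p q) (fun j _ => h0 k p j) (Finset.mem_univ q)
  have hsum : ∀ p q, Summable fun k => γ ^ k * (S ^ k) p q := fun p q =>
    Summable.of_nonneg_of_le (fun k => mul_nonneg (pow_nonneg hγ0 k) (h0 k p q))
      (fun k => mul_le_of_le_one_right (pow_nonneg hγ0 k) (hle k p q))
      (summable_geometric_of_lt_one hγ0 hγ1)
  have hrec : ∀ p q, ∑' k, γ ^ k * (S ^ k) p q =
      (1 : Matrix I I ℝ) p q + γ * ∑ r, (∑' k, γ ^ k * (S ^ k) p r) * S r q := by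
    intro p q
    rw [(hsum p q).tsum_eq_zero_add]
    simp only [pow_zero, one_mul]
    congr 1
    simp only [← tsum_mul_right]
    rw [← Summable.tsum_finsetSum (fun r _ => (hsum p r).mul_right _), ← tsum_mul_left]
    refine tsum_congr fun k => ?_
    rw [pow_succ S, Matrix.mul_apply, Finset.mul_sum, Finset.mul_sum]
    exact Finset.sum_congr rfl fun r _ => by ring
  have hw : ∀ q, ∑ p, ∑' k, γ ^ k * (S ^ k) p q =
      1 + γ * ∑ r, (∑ p, ∑' k, γ ^ k * (S ^ k) p r) * S r q := by
    intro q
    rw [Finset.sum_congr rfl fun p _ => hrec p q, Finset.sum_add_distrib]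
    congr 1
    · simp [Matrix.one_apply]
    · rw [← Finset.mul_sum, Finset.sum_comm]
      simp only [Finset.sum_mul]
  have hnn : ∀ q, 0 ≤ ∑ p, ∑' k, γ ^ k * (S ^ k) p q := fun q => Finset.sum_nonneg fun p _ =>
    tsum_nonneg fun k => mul_nonneg (pow_nonneg hγ0 k) (h0 k p q)
  refine ⟨fun q => ∑ p, ∑' k, γ ^ k * (S ^ k) p q, fun q => ?_, fun q => ?_⟩
  · show 1 ≤ ∑ p, ∑' k, γ ^ k * (S ^ k) p q
    rw [hw q]
    have : 0 ≤ γ * ∑ r, (∑ p, ∑' k, γ ^ k * (S ^ k) p r) * S r q :=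
      mul_nonneg hγ0 (Finset.sum_nonneg fun r _ => mul_nonneg (hnn r) (hS0 r q))
    linarith
  · simp only
    rw [hw q]
    linarith

lemma aux_softmax_meas {X : Type} [Fintype X] {Ω : Type} {m : MeasurableSpace Ω}
    (f : Ω → X → ℝ) (hf : ∀ x, Measurable fun ω => f ω x) (x : X) :
    Measurable fun ω => softmax (f ω) x := by
  unfold softmax
  exact (Real.measurable_exp.comp (hf x)).div
    (Finset.measurable_sum _ fun j _ => Real.measurable_exp.comp (hf j))

lemma aux_ae_summable {Ω : Type} {mΩ : MeasurableSpace Ω} (Pr : Measure Ω)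
    (f : ℕ → Ω → ℝ) (hf0 : ∀ k ω, 0 ≤ f k ω) (hfi : ∀ k, Integrable (f k) Pr) (R : ℝ)
    (hR : ∀ n, ∑ k ∈ Finset.range n, ∫ ω, f k ω ∂Pr ≤ R) :
    ∀ᵐ ω ∂Pr, Summable fun k => f k ω := by
  have hS : Summable fun k => ∫ ω, f k ω ∂Pr :=
    summable_of_sum_range_le (fun k => integral_nonneg (hf0 k)) hR
  have h1 : ∫⁻ ω, ∑' k, ENNReal.ofReal (f k ω) ∂Pr ≠ ⊤ := by
    rw [lintegral_tsum fun k => (hfi k).aestronglyMeasurable.aemeasurable.ennreal_ofReal]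
    have : ∀ k, ∫⁻ ω, ENNReal.ofReal (f k ω) ∂Pr = ENNReal.ofReal (∫ ω, f k ω ∂Pr) := fun k =>
      (ofReal_integral_eq_lintegral_ofReal (hfi k) (ae_of_all _ (hf0 k))).symm
    simp only [this]
    exact hS.tsum_ofReal_ne_top
  have h2 := ae_lt_top' (AEMeasurable.ennreal_tsum
    fun k => (hfi k).aestronglyMeasurable.aemeasurable.ennreal_ofReal) h1
  filter_upwards [h2] with ω hω
  have := ENNReal.summable_toReal hω.ne
  simpa only [ENNReal.toReal_ofReal (hf0 _ ω)] using this

lemma aux_core {I X : Type} [Fintype I] [Fintype X] [Nonempty X]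
    (S : I → I → ℝ) (hS0 : ∀ p q, 0 ≤ S p q)
    (hS1 : ∀ p, ∑ q, S p q = 1) (γ : ℝ) (hγ0 : 0 ≤ γ) (hγ1 : γ < 1)
    (w : I → ℝ) (hw : ∀ p, 1 ≤ w p)
    (hwS : ∀ q, γ * ∑ p, w p * S p q ≤ w q)
    (m : I → X → ℝ) (hm0 : ∀ p x, 0 ≤ m p x) (hm1 : ∀ p, ∑ x, m p x = 1)
    {Ω : Type} {mΩ : MeasurableSpace Ω} (Pr : Measure Ω) [IsProbabilityMeasure Pr]
    (ℱ : Filtration ℕ mΩ)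
    (φ : ℕ → Ω → I → X → ℝ)
    (hφ0 : ∀ ω ω', φ 0 ω = φ 0 ω')
    (hφmeas : ∀ k p x, Measurable[ℱ k] fun ω => φ k ω p x)
    (Δ : ℕ → Ω → I → X → ℝ)
    (hΔmeas : ∀ k p x, Measurable fun ω => Δ k ω p x)
    (C : ℝ) (hC : 0 ≤ C)
    (hΔbdd : ∀ k p x, ∀ᵐ ω ∂Pr, |Δ k ω p x| ≤ C)
    (hΔcond : ∀ k p x,
      Pr[fun ω => Δ k ω p x|ℱ k] =ᵐ[Pr] fun ω =>
        m p x + γ * ∑ q, S p q * (softmax (φ k ω q) x - m q x))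
    (ε : ℕ → ℝ) (hε0 : ∀ k, 0 ≤ ε k)
    (hεdiv : ¬ Summable ε) (hεsq : Summable fun k => ε k ^ 2)
    (hupd : ∀ k ω p x,
      φ (k + 1) ω p x =
        φ k ω p x + ε k * (Δ k ω p x - softmax (φ k ω p) x)) :
    ∀ᵐ ω ∂Pr, ∀ p x, Tendsto (fun k => softmax (φ k ω p) x) atTop (nhds (m p x)) := by
  obtain ⟨E, hE⟩ : ∃ E, ∀ k, ε k ≤ E := by
    have h1 : Tendsto (fun k => ε k ^ 2) atTop (nhds 0) := hεsq.tendsto_atTop_zero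
    obtain ⟨E, hE⟩ := h1.bddAbove_range
    refine ⟨E + 1, fun k => ?_⟩
    have := hE ⟨k, rfl⟩
    simp only at this
    nlinarith [sq_nonneg (ε k - 1), sq_nonneg (ε k), hε0 k]
  have hw0 : ∀ p, 0 ≤ w p := fun p => zero_le_one.trans (hw p)
  -- a.e. bounds
  have hbd : ∀ᵐ ω ∂Pr, ∀ k p x, |Δ k ω p x| ≤ C := by
    simp only [ae_all_iff]; exact hΔbdd
  have hv : ∀ᵐ ω ∂Pr, ∀ k p x, |ε k * (Δ k ω p x - softmax (φ k ω p) x)| ≤ ε k * (C + 1) := by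
    filter_upwards [hbd] with ω hω k p x
    rw [abs_mul, abs_of_nonneg (hε0 k)]
    refine mul_le_mul_of_nonneg_left ?_ (hε0 k)
    have h1 := abs_le.1 (hω k p x)
    have h2 := aux_softmax_nonneg (φ k ω p) x
    have h3 := aux_softmax_le (φ k ω p) x
    rw [abs_le]; constructor <;> linarith
  have hfun : ∀ k ω p, φ (k + 1) ω p =
      fun x => φ k ω p x + ε k * (Δ k ω p x - softmax (φ k ω p) x) :=
    fun k ω p => funext fun x => hupd k ω p x
  let d : ℕ → Ω → I → X → ℝ := fun k ω p x => softmax (φ k ω p) x - m p x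
  let T : ℕ → Ω → I → X → ℝ := fun k ω p x => m p x + γ * ∑ q, S p q * d k ω q x
  let D : ℕ → Ω → ℝ := fun k ω => ∑ p, w p * ∑ x, d k ω p x ^ 2
  let N : ℕ → Ω → ℝ := fun k ω => ∑ p, w p * ∑ x, d k ω p x * (Δ k ω p x - T k ω p x)
  let L : ℕ → Ω → ℝ := fun k ω =>
    ∑ p, w p * (Real.log (∑ x, Real.exp (φ k ω p x)) - ∑ x, m p x * φ k ω p x)
  have hm_le : ∀ p x, m p x ≤ 1 := fun p x => by
    rw [← hm1 p]; exact Finset.single_le_sum (fun j _ => hm0 p j) (Finset.mem_univ x)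
  have hd1 : ∀ k ω p x, |d k ω p x| ≤ 1 := by
    intro k ω p x
    have h2 := aux_softmax_nonneg (φ k ω p) x
    have h3 := aux_softmax_le (φ k ω p) x
    have h4 := hm_le p x
    have h5 := hm0 p x
    simp only [d]
    rw [abs_le]; constructor <;> linarith
  have hdmeas : ∀ k p x, Measurable[ℱ k] fun ω => d k ω p x := fun k p x =>
    (aux_softmax_meas (m := ℱ k) _ (hφmeas k p) x).sub_const _
  have hdmeas' : ∀ k p x, Measurable fun ω => d k ω p x := fun k p x =>
    (hdmeas k p x).mono (ℱ.le k) le_rfl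
  have hTmeas : ∀ k p x, Measurable fun ω => T k ω p x := fun k p x =>
    ((Finset.measurable_sum _ fun q _ => (hdmeas' k q x).const_mul _).const_mul _).const_add _
  have hΔint : ∀ k p x, Integrable (fun ω => Δ k ω p x) Pr := fun k p x =>
    Integrable.of_bound (hΔmeas k p x).aestronglyMeasurable C (hΔbdd k p x)
  have hTint : ∀ k p x, Integrable (fun ω => T k ω p x) Pr := fun k p x =>
    integrable_condExp.congr (hΔcond k p x)
  have hdm : ∀ (k : ℕ) p x (g : Ω → ℝ), Integrable g Pr →
      Integrable (fun ω => d k ω p x * g ω) Pr := fun k p x g hg =>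
    hg.bdd_mul (c := 1) (hdmeas' k p x).aestronglyMeasurable (ae_of_all _ fun ω => hd1 k ω p x)
  have hNint1 : ∀ k p x, Integrable (fun ω => d k ω p x * (Δ k ω p x - T k ω p x)) Pr :=
    fun k p x => hdm k p x _ ((hΔint k p x).sub (hTint k p x))
  have hN1 : ∀ k p x, ∫ ω, d k ω p x * (Δ k ω p x - T k ω p x) ∂Pr = 0 := by
    intro k p x
    have h1 : ∫ ω, d k ω p x * Δ k ω p x ∂Pr = ∫ ω, d k ω p x * T k ω p x ∂Pr := by
      have h2 := condExp_stronglyMeasurable_mul_of_bound (ℱ.le k) (μ := Pr)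
        (f := fun ω => d k ω p x) (hdmeas k p x).stronglyMeasurable (hΔint k p x) 1
        (ae_of_all _ fun ω => hd1 k ω p x)
      have h3 := integral_condExp (ℱ.le k) (μ := Pr)
        (f := (fun ω => d k ω p x) * fun ω => Δ k ω p x)
      calc ∫ ω, d k ω p x * Δ k ω p x ∂Pr = _ := h3.symm
        _ = _ := by
          refine integral_congr_ae ?_
          filter_upwards [h2, hΔcond k p x] with ω h4 h5
          rw [h4, Pi.mul_apply, h5]
    simp only [mul_sub]
    rw [integral_sub (hdm k p x _ (hΔint k p x)) (hdm k p x _ (hTint k p x)), h1, sub_self]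
  have hNint : ∀ k, Integrable (N k) Pr := fun k =>
    integrable_finsetSum _ fun p _ => (integrable_finsetSum _ fun x _ => hNint1 k p x).const_mul _
  have hN0 : ∀ k, ∫ ω, N k ω ∂Pr = 0 := by
    intro k
    simp only [N]
    rw [integral_finsetSum _ fun p _ =>
      (integrable_finsetSum _ fun x _ => hNint1 k p x).const_mul _]
    refine Finset.sum_eq_zero fun p _ => ?_
    rw [integral_const_mul, integral_finsetSum _ fun x _ => hNint1 k p x]
    simp [hN1]
  have hD0 : ∀ k ω, 0 ≤ D k ω := fun k ω => Finset.sum_nonneg fun p _ =>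
    mul_nonneg (hw0 p) (Finset.sum_nonneg fun x _ => sq_nonneg _)
  have hDint : ∀ k, Integrable (D k) Pr := by
    intro k
    refine integrable_finsetSum _ fun p _ => (integrable_finsetSum _ fun x _ => ?_).const_mul _
    refine Integrable.of_bound ((hdmeas' k p x).pow_const 2).aestronglyMeasurable 1
      (ae_of_all _ fun ω => ?_)
    rw [Real.norm_eq_abs, abs_pow]
    exact pow_le_one₀ (abs_nonneg _) (hd1 k ω p x)
  have hL0 : ∀ k ω, 0 ≤ L k ω := fun k ω => Finset.sum_nonneg fun p _ =>
    mul_nonneg (hw0 p) (aux_lse_lower _ _ (hm0 p) (hm1 p))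
  set c := (1 - γ) / 2 with hc
  have hc0 : 0 < c := by rw [hc]; linarith
  set K := (∑ p, w p) * ((C + 1) ^ 2 * Real.exp (E * (C + 1))) with hK
  have hstep : ∀ᵐ ω ∂Pr, ∀ k, L (k + 1) ω ≤ L k ω - c * (ε k * D k ω) + ε k * N k ω + K * ε k ^ 2 := by
    filter_upwards [hv] with ω hω k
    have h1 : ∀ p, Real.log (∑ x, Real.exp (φ (k+1) ω p x)) - ∑ x, m p x * φ (k+1) ω p x ≤
        (Real.log (∑ x, Real.exp (φ k ω p x)) - ∑ x, m p x * φ k ω p x) +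
        ε k * (∑ x, d k ω p x * (Δ k ω p x - T k ω p x)) +
        ε k * (∑ x, d k ω p x * (γ * ∑ q, S p q * d k ω q x - d k ω p x)) +
        (C + 1) ^ 2 * Real.exp (E * (C + 1)) * ε k ^ 2 := by
      intro p
      have h2 := aux_lse_step (φ k ω p) (fun x => ε k * (Δ k ω p x - softmax (φ k ω p) x))
        (ε k * (C + 1)) (hω k p)
      have h3 : Real.exp (ε k * (C + 1)) ≤ Real.exp (E * (C + 1)) :=
        Real.exp_le_exp.2 (mul_le_mul_of_nonneg_right (hE k) (by linarith))
      have h4 : (ε k * (C + 1)) ^ 2 * Real.exp (ε k * (C + 1)) ≤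
          (C + 1) ^ 2 * Real.exp (E * (C + 1)) * ε k ^ 2 := by
        calc _ ≤ (ε k * (C + 1)) ^ 2 * Real.exp (E * (C + 1)) := by gcongr
          _ = _ := by ring
      have h5 : ∑ x, softmax (φ k ω p) x * (ε k * (Δ k ω p x - softmax (φ k ω p) x))
          - ∑ x, m p x * φ (k+1) ω p x = - ∑ x, m p x * φ k ω p x +
          ε k * (∑ x, d k ω p x * (Δ k ω p x - T k ω p x)) +
          ε k * (∑ x, d k ω p x * (γ * ∑ q, S p q * d k ω q x - d k ω p x)) := by
        rw [Finset.mul_sum, Finset.mul_sum, ← Finset.sum_neg_distrib, ← Finset.sum_add_distrib,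
          ← Finset.sum_add_distrib, ← Finset.sum_sub_distrib]
        refine Finset.sum_congr rfl fun x _ => ?_
        rw [hupd]
        simp only [T]
        have : d k ω p x = softmax (φ k ω p) x - m p x := rfl
        have h6 : softmax (φ k ω p) x = d k ω p x + m p x := by rw [this]; ring
        rw [h6]
        ring
      have h6 : ∀ x, φ (k+1) ω p x = φ k ω p x + ε k * (Δ k ω p x - softmax (φ k ω p) x) :=
        hupd k ω p
      have h7 : ∑ x, Real.exp (φ (k+1) ω p x) =
          ∑ x, Real.exp (φ k ω p x + ε k * (Δ k ω p x - softmax (φ k ω p) x)) := by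
        simp only [h6]
      rw [h7]
      linarith
    have h8 := aux_drift S hS0 hS1 γ hγ0 w hw0 hwS (d k ω)
    calc L (k+1) ω ≤ ∑ p, w p * (_ + _ + _ + _) :=
          Finset.sum_le_sum fun p _ => mul_le_mul_of_nonneg_left (h1 p) (hw0 p)
      _ = L k ω + ε k * N k ω +
          ε k * (∑ p, w p * ∑ x, d k ω p x * (γ * ∑ q, S p q * d k ω q x - d k ω p x))
          + K * ε k ^ 2 := by
          simp only [mul_add, Finset.sum_add_distrib]
          congr 1
          · congr 1
            · congr 1
              simp only [N]
              rw [Finset.mul_sum]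
              exact Finset.sum_congr rfl fun p _ => by ring
            · rw [Finset.mul_sum]
              exact Finset.sum_congr rfl fun p _ => by ring
          · rw [hK, Finset.sum_mul, Finset.sum_mul]
            exact Finset.sum_congr rfl fun p _ => by ring
      _ ≤ _ := by
          have h9 := mul_le_mul_of_nonneg_left h8 (hε0 k)
          have h10 : ε k * (-((1 - γ) / 2) * ∑ p, w p * ∑ x, d k ω p x ^ 2) =
              -(c * (ε k * D k ω)) := by
            rw [hc]
            show ε k * (-((1 - γ) / 2) * D k ω) = _
            ring
          rw [h10] at h9
          linarith
  have hK0 : 0 ≤ K := mul_nonneg (Finset.sum_nonneg fun p _ => hw0 p) (by positivity)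
  obtain ⟨ω₀⟩ : Nonempty Ω := Pr.nonempty_of_neZero
  have hL00 : ∀ ω, L 0 ω = L 0 ω₀ := fun ω => by simp only [L, hφ0 ω ω₀]
  have htel : ∀ᵐ ω ∂Pr, ∀ n, ∑ k ∈ Finset.range n, c * (ε k * D k ω) ≤
      (L 0 ω₀ + K * ∑' k, ε k ^ 2) + ∑ k ∈ Finset.range n, ε k * N k ω := by
    filter_upwards [hstep] with ω hω n
    have h1 : ∀ n, ∑ k ∈ Finset.range n, c * (ε k * D k ω) + L n ω ≤
      L 0 ω₀ + K * ∑ k ∈ Finset.range n, ε k ^ 2 + ∑ k ∈ Finset.range n, ε k * N k ω := by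
      intro n
      induction n with
      | zero => simp [hL00 ω]
      | succ n ih =>
        simp only [Finset.sum_range_succ]
        linarith [hω n]
    have h2 : ∑ k ∈ Finset.range n, ε k ^ 2 ≤ ∑' k, ε k ^ 2 :=
      hεsq.sum_le_tsum _ fun k _ => sq_nonneg _
    have h3 := mul_le_mul_of_nonneg_left h2 hK0
    linarith [h1 n, hL0 n ω]
  have hsum : ∀ᵐ ω ∂Pr, Summable fun k => c * (ε k * D k ω) := by
    have hi : ∀ k, Integrable (fun ω => c * (ε k * D k ω)) Pr := fun k =>
      ((hDint k).const_mul _).const_mul _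
    refine aux_ae_summable Pr (fun k ω => c * (ε k * D k ω))
      (fun k ω => mul_nonneg hc0.le (mul_nonneg (hε0 k) (hD0 k ω))) hi
      (L 0 ω₀ + K * ∑' k, ε k ^ 2) fun n => ?_
    rw [← integral_finsetSum _ fun k _ => hi k]
    have hi2 : Integrable (fun ω => ∑ k ∈ Finset.range n, ε k * N k ω) Pr :=
      integrable_finsetSum _ fun k _ => (hNint k).const_mul _
    calc _ ≤ ∫ ω, ((L 0 ω₀ + K * ∑' k, ε k ^ 2) + ∑ k ∈ Finset.range n, ε k * N k ω) ∂Pr := by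
          refine integral_mono_ae (integrable_finsetSum _ fun k _ => hi k)
            ((integrable_const _).add hi2) ?_
          filter_upwards [htel] with ω hω using hω n
      _ = _ := by
          rw [integral_add (integrable_const _) hi2,
            integral_finsetSum _ fun k _ => (hNint k).const_mul _]
          simp [integral_const_mul, hN0]
  filter_upwards [hsum, hv] with ω hs hω p x
  have hd : Tendsto (fun k => d k ω p x) atTop (nhds 0) := by
    refine aux_cube ε _ hε0 hεdiv hεsq (2 * (C + 1) * Real.exp (2 * (E * (C + 1)))) ?_ ?_
    · intro k
      have h1 := aux_softmax_lip (φ k ω p) (fun x => ε k * (Δ k ω p x - softmax (φ k ω p) x))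
        (ε k * (C + 1)) (hω k p) x
      have h2 : d (k+1) ω p x - d k ω p x = softmax (fun x => φ k ω p x +
          ε k * (Δ k ω p x - softmax (φ k ω p) x)) x - softmax (φ k ω p) x := by
        simp only [d]
        rw [hfun]; ring
      rw [h2]
      have h0 := hε0 k
      refine h1.trans ?_
      calc _ ≤ 2 * (ε k * (C + 1)) * Real.exp (2 * (E * (C + 1))) := by
            gcongr; exact hE k
        _ = _ := by ring
    · refine Summable.of_nonneg_of_le (fun k => mul_nonneg (hε0 k) (sq_nonneg _)) (fun k => ?_)
        (hs.mul_left (1 / c))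
      have h1 : d k ω p x ^ 2 ≤ D k ω := by
        calc d k ω p x ^ 2 ≤ ∑ x, d k ω p x ^ 2 :=
              Finset.single_le_sum (f := fun x => d k ω p x ^ 2) (fun _ _ => sq_nonneg _)
                (Finset.mem_univ x)
          _ ≤ w p * ∑ x, d k ω p x ^ 2 :=
              le_mul_of_one_le_left (Finset.sum_nonneg fun x _ => sq_nonneg _) (hw p)
          _ ≤ _ := Finset.single_le_sum (f := fun p => w p * ∑ x, d k ω p x ^ 2)
              (fun p _ => mul_nonneg (hw0 p) (Finset.sum_nonneg fun x _ => sq_nonneg _))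
              (Finset.mem_univ p)
      calc _ ≤ ε k * D k ω := mul_le_mul_of_nonneg_left h1 (hε0 k)
        _ = _ := by field_simp
  have := hd.add_const (m p x)
  simpa [d] using this

lemma aux_visit {X A : Type} [Fintype X] [Fintype A] [DecidableEq X] [DecidableEq A]
    (P : X → A → X → ℝ) (hP0 : ∀ x a x', 0 ≤ P x a x')
    (hP1 : ∀ x a, ∑ x', P x a x' = 1)
    (π : X → A → ℝ) (hπ0 : ∀ x a, 0 ≤ π x a) (hπ1 : ∀ x, ∑ a, π x a = 1)
    (γ : ℝ) (hγ0 : 0 ≤ γ) (hγ1 : γ < 1)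
    (h0 : ∀ k p q, 0 ≤ (stateActionMatrix P π ^ k) p q)
    (h1 : ∀ k p, ∑ q, (stateActionMatrix P π ^ k) p q = 1) :
    (∀ x a x', 0 ≤ visit P π γ x a x') ∧ (∀ x a, ∑ x', visit P π γ x a x' = 1) ∧
    ∀ x a x', visit P π γ x a x' = (1 - γ) * P x a x' +
      γ * ∑ q : X × A, stateActionMatrix P π (x, a) q * visit P π γ q.1 q.2 x' := by
  set S := stateActionMatrix P π with hS
  let f : ℕ → X × A → X → ℝ := fun k p x' => ∑ a', (S ^ (k + 1)) p (x', a')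
  have hf0 : ∀ k p x', 0 ≤ f k p x' := fun k p x' => Finset.sum_nonneg fun a' _ => h0 _ _ _
  have hf1 : ∀ k p, ∑ x', f k p x' = 1 := by
    intro k p
    rw [← h1 (k + 1) p, Fintype.sum_prod_type]
  have hfle : ∀ k p x', f k p x' ≤ 1 := fun k p x' => by
    rw [← hf1 k p]
    exact Finset.single_le_sum (fun j _ => hf0 k p j) (Finset.mem_univ x')
  have hsum : ∀ p x', Summable fun k => γ ^ k * f k p x' := fun p x' =>
    Summable.of_nonneg_of_le (fun k => mul_nonneg (pow_nonneg hγ0 k) (hf0 k p x'))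
      (fun k => mul_le_of_le_one_right (pow_nonneg hγ0 k) (hfle k p x'))
      (summable_geometric_of_lt_one hγ0 hγ1)
  have hvis : ∀ x a x', visit P π γ x a x' = (1 - γ) * ∑' k, γ ^ k * f k (x, a) x' :=
    fun x a x' => rfl
  refine ⟨fun x a x' => ?_, fun x a => ?_, fun x a x' => ?_⟩
  · rw [hvis]
    exact mul_nonneg (by linarith) (tsum_nonneg fun k => mul_nonneg (pow_nonneg hγ0 k) (hf0 _ _ _))
  · simp only [hvis]
    rw [← Finset.mul_sum, ← Summable.tsum_finsetSum (fun x' _ => hsum (x, a) x')]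
    simp only [← Finset.mul_sum, hf1, mul_one]
    rw [tsum_geometric_of_lt_one hγ0 hγ1]
    exact mul_inv_cancel₀ (by linarith)
  · have hz : f 0 (x, a) x' = P x a x' := by
      simp only [f, zero_add, pow_one, hS, stateActionMatrix, Matrix.of_apply]
      rw [← Finset.mul_sum, hπ1, mul_one]
    have hsucc : ∀ k, f (k + 1) (x, a) x' = ∑ q, S (x, a) q * f k q x' := by
      intro k
      simp only [f]
      rw [Finset.sum_congr rfl fun a' _ => by rw [pow_succ' S (k + 1), Matrix.mul_apply]]
      rw [Finset.sum_comm]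
      simp only [Finset.mul_sum]
    rw [hvis, (hsum (x, a) x').tsum_eq_zero_add, hz]
    simp only [hvis, pow_zero, one_mul, mul_add]
    congr 1
    have : ∑ q : X × A, S (x, a) q * ((1 - γ) * ∑' k, γ ^ k * f k (q.1, q.2) x')
        = (1 - γ) * ∑' k, γ ^ k * f (k + 1) (x, a) x' := by
      simp only [hsucc, Finset.mul_sum]
      rw [Summable.tsum_finsetSum, Finset.mul_sum]
      · refine Finset.sum_congr rfl fun q _ => ?_
        rw [← tsum_mul_left, ← tsum_mul_left, ← tsum_mul_left]
        exact tsum_congr fun k => by ring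
      · intro q _
        refine ((hsum q x').mul_left (S (x, a) q)).congr fun k => by ring
    rw [this, ← tsum_mul_left, ← tsum_mul_left, ← tsum_mul_left]
    exact tsum_congr fun k => by ring

/-- **Convergence of synchronous cross-entropy temporal-difference (CETD) learning.**
Logits `φ k` (measurable w.r.t. a filtration `ℱ`, with `φ 0` deterministic) are updated by
`φ (k+1) = φ k + ε k • (Δ k - softmax (φ k))` per state-action pair, where `Δ k` is
`ℱ (k+1)`-measurable, uniformly bounded, and has conditional expectation given `ℱ k`
equal to the distributional Bellman operator `T^π_γ` applied to `μ k = softmax (φ k)`.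
If `∑ ε k = ∞` and `∑ (ε k)² < ∞`, then almost surely `μ k (·|x,a) → μ^π_γ(·|x,a)`
for every `(x,a)`. -/
theorem cetd_convergence
    {X A : Type} [Fintype X] [Fintype A] [DecidableEq X] [DecidableEq A]
    [Nonempty X] [Nonempty A]
    (P : X → A → X → ℝ) (hP0 : ∀ x a x', 0 ≤ P x a x')
    (hP1 : ∀ x a, ∑ x', P x a x' = 1)
    (π : X → A → ℝ) (hπ0 : ∀ x a, 0 ≤ π x a) (hπ1 : ∀ x, ∑ a, π x a = 1)
    (γ : ℝ) (hγ0 : 0 ≤ γ) (hγ1 : γ < 1)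
    {Ω : Type} {mΩ : MeasurableSpace Ω} (Pr : Measure Ω) [IsProbabilityMeasure Pr]
    (ℱ : Filtration ℕ mΩ)
    (φ : ℕ → Ω → X → A → X → ℝ)
    (hφ0 : ∀ ω ω', φ 0 ω = φ 0 ω')
    (hφmeas : ∀ k, Measurable[ℱ k] (φ k))
    (Δ : ℕ → Ω → X → A → X → ℝ)
    (hΔmeas : ∀ k, Measurable[ℱ (k + 1)] (Δ k))
    (C : ℝ)
    (hΔbdd : ∀ k x a, ∀ᵐ ω ∂Pr, ‖Δ k ω x a‖ ≤ C)
    (hΔcond : ∀ k x a x',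
      Pr[fun ω => Δ k ω x a x'|ℱ k] =ᵐ[Pr] fun ω =>
        (1 - γ) * P x a x' +
          γ * ∑ x'' : X, ∑ a'' : A, P x a x'' * π x'' a'' * softmax (φ k ω x'' a'') x')
    (ε : ℕ → ℝ) (hε0 : ∀ k, 0 ≤ ε k)
    (hεdiv : ¬ Summable ε) (hεsq : Summable fun k => ε k ^ 2)
    (hupd : ∀ k ω x a x',
      φ (k + 1) ω x a x' =
        φ k ω x a x' + ε k * (Δ k ω x a x' - softmax (φ k ω x a) x')) :
    ∀ᵐ ω ∂Pr, ∀ x a x',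
      Tendsto (fun k => softmax (φ k ω x a) x') atTop (nhds (visit P π γ x a x')) := by
  have hS0 : ∀ p q, 0 ≤ stateActionMatrix P π p q := fun p q => mul_nonneg (hP0 _ _ _) (hπ0 _ _)
  have hS1 : ∀ p, ∑ q, stateActionMatrix P π p q = 1 := by
    intro p
    simp only [stateActionMatrix, Matrix.of_apply]
    rw [Fintype.sum_prod_type]
    simp only [← Finset.mul_sum, hπ1, mul_one, hP1]
  obtain ⟨h0, h1, w, hw, hwS⟩ := aux_weight (stateActionMatrix P π) hS0 hS1 γ hγ0 hγ1
  obtain ⟨hv0, hv1, hv2⟩ := aux_visit P hP0 hP1 π hπ0 hπ1 γ hγ0 hγ1 h0 h1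
  have hC : 0 ≤ C := by
    obtain ⟨x⟩ := ‹Nonempty X›
    obtain ⟨a⟩ := ‹Nonempty A›
    obtain ⟨ω, hω⟩ := (hΔbdd 0 x a).exists
    exact (norm_nonneg _).trans hω
  have key := aux_core (I := X × A) (X := X) (fun p q => stateActionMatrix P π p q) hS0 hS1 γ
    hγ0 hγ1 w hw hwS (fun p x' => visit P π γ p.1 p.2 x') (fun p x' => hv0 _ _ _)
    (fun p => hv1 _ _) Pr ℱ (fun k ω p x' => φ k ω p.1 p.2 x')
    (fun ω ω' => by rw [hφ0 ω ω'])
    (fun k p x' => ((measurable_pi_apply x').comp ((measurable_pi_apply p.2).comp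
      ((measurable_pi_apply p.1).comp (hφmeas k)))))
    (fun k ω p x' => Δ k ω p.1 p.2 x')
    (fun k p x' => (((measurable_pi_apply x').comp ((measurable_pi_apply p.2).comp
      ((measurable_pi_apply p.1).comp (hΔmeas k)))).mono (ℱ.le (k + 1)) le_rfl))
    C hC
    (fun k p x' => by
      filter_upwards [hΔbdd k p.1 p.2] with ω hω
      exact (norm_le_pi_norm (Δ k ω p.1 p.2) x').trans hω)
    (fun k p x' => by
      filter_upwards [hΔcond k p.1 p.2 x'] with ω hω
      rw [hω, hv2 p.1 p.2 x']
      simp only [mul_sub, Finset.sum_sub_distrib]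
      have : ∑ x'' : X, ∑ a'' : A, P p.1 p.2 x'' * π x'' a'' * softmax (φ k ω x'' a'') x' =
          ∑ q : X × A, stateActionMatrix P π p q * softmax (φ k ω q.1 q.2) x' := by
        rw [Fintype.sum_prod_type]
        rfl
      rw [this]
      ring)
    ε hε0 hεdiv hεsq (fun k ω p x' => hupd k ω p.1 p.2 x')
  filter_upwards [key] with ω hω x a x'
  exact hω (x, a) x'
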